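/- Let T > 0, let z, a : [0,T] → ℝ be measurable bounded functions with z(t) ≥ 0 for all t ∈ [0,T], let c : [0,T] → ℝ be a nonnegative non-decreasing measurable bounded function, and let β : [0,T] → ℝ be a nonnegative integrable function. If z(t) ≤ c(t) − a(t) + ∫₀ᵗ β(s) z(s) ds for all t ∈ [0,T], then a(t) + ∫₀ᵗ a(s) β(s) exp(∫ₛᵗ β(w) dw) ds ≤ c(t) · exp(∫₀ᵗ β(s) ds) for all t ∈ [0,T]. -/

import Mathlib

open MeasureTheory Set in
theorem LipschitzOnWith.comp_absolutelyContinuousOnInterval {X Y : Type*}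
    [PseudoMetricSpace X] [PseudoMetricSpace Y] {g : X → Y} {f : ℝ → X} {K : NNReal} {s : Set X}
    {a b : ℝ} (hg : LipschitzOnWith K g s) (hf : AbsolutelyContinuousOnInterval f a b)
    (hs : MapsTo f (uIcc a b) s) : AbsolutelyContinuousOnInterval (g ∘ f) a b := by
  unfold AbsolutelyContinuousOnInterval at hf ⊢
  refine squeeze_zero' (.of_forall fun _ ↦ Finset.sum_nonneg fun i hi ↦ dist_nonneg) ?_
    (by simpa using hf.const_mul (K : ℝ))
  rw [Filter.eventually_inf_principal]
  filter_upwards with E hE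
  rw [Finset.mul_sum]
  exact Finset.sum_le_sum fun i hi ↦
    hg.dist_le_mul _ (hs (hE.1 i hi).1) _ (hs (hE.1 i hi).2)

open Set in
theorem ContDiff.comp_absolutelyContinuousOnInterval {g f : ℝ → ℝ} {a b : ℝ}
    (hg : ContDiff ℝ 1 g) (hf : AbsolutelyContinuousOnInterval f a b) :
    AbsolutelyContinuousOnInterval (g ∘ f) a b := by
  obtain ⟨C, hC⟩ := hf.exists_bound
  obtain ⟨K, hK⟩ := (hg.contDiffOn (s := Icc (-C) C)).exists_lipschitzOnWith (by decide)
    (convex_Icc _ _) isCompact_Icc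
  exact hK.comp_absolutelyContinuousOnInterval hf fun x hx ↦ abs_le.mp (hC x hx)

open MeasureTheory Set in
theorem IntervalIntegrable.bdd_mul_of_le {f g : ℝ → ℝ} {a b : ℝ} (hab : a ≤ b)
    (hg : IntervalIntegrable g volume a b) (hf : Measurable f) {C : ℝ}
    (hC : ∀ x ∈ Icc a b, |f x| ≤ C) :
    IntervalIntegrable (fun x ↦ f x * g x) volume a b := by
  rw [intervalIntegrable_iff_integrableOn_Icc_of_le hab] at hg ⊢
  exact hg.bdd_mul hf.aestronglyMeasurable
    ((ae_restrict_iff' measurableSet_Icc).2 (.of_forall hC))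


/-- Abstract Gronwall-type lemma (deterministic skeleton of estimates (3.15)–(3.17)):
if 0 ≤ z(t) ≤ c(t) − a(t) + ∫₀ᵗ β z with c nonnegative non-decreasing, then
a(t) + ∫₀ᵗ a(s) β(s) exp(∫ₛᵗ β) ds ≤ c(t) exp(∫₀ᵗ β). -/
theorem gronwall_error_bound_skeleton_monotone
    (T : ℝ) (hT : 0 < T) (z a c : ℝ → ℝ)
    (hzm : Measurable z) (ham : Measurable a) (hcm : Measurable c)
    (hzb : ∃ C, ∀ t ∈ Set.Icc (0:ℝ) T, |z t| ≤ C)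
    (hab : ∃ C, ∀ t ∈ Set.Icc (0:ℝ) T, |a t| ≤ C)
    (hcb : ∃ C, ∀ t ∈ Set.Icc (0:ℝ) T, |c t| ≤ C)
    (hznonneg : ∀ t ∈ Set.Icc (0:ℝ) T, 0 ≤ z t)
    (hcnonneg : ∀ t ∈ Set.Icc (0:ℝ) T, 0 ≤ c t)
    (hcmono : MonotoneOn c (Set.Icc (0:ℝ) T))
    (β : ℝ → ℝ) (hβm : Measurable β)
    (hβnonneg : ∀ t ∈ Set.Icc (0:ℝ) T, 0 ≤ β t)
    (hβint : IntervalIntegrable β MeasureTheory.volume 0 T)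
    (hineq : ∀ t ∈ Set.Icc (0:ℝ) T, z t ≤ c t - a t + ∫ s in (0:ℝ)..t, β s * z s) :
    ∀ t ∈ Set.Icc (0:ℝ) T,
      a t + (∫ s in (0:ℝ)..t, a s * β s * Real.exp (∫ w in s..t, β w))
        ≤ c t * Real.exp (∫ s in (0:ℝ)..t, β s) := by
  intro t ht
  obtain ⟨Cz, hCz⟩ := hzb
  obtain ⟨Ca, hCa⟩ := hab
  have hsub : Set.Icc 0 t ⊆ Set.Icc 0 T := Set.Icc_subset_Icc_right ht.2
  have hu : Set.uIcc 0 t = Set.Icc 0 t := Set.uIcc_of_le ht.1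
  have hβt : IntervalIntegrable β MeasureTheory.volume 0 t :=
    hβint.mono_set (by rwa [hu, Set.uIcc_of_le hT.le])
  have hβz : IntervalIntegrable (fun s ↦ β s * z s) MeasureTheory.volume 0 t := by
    simpa only [mul_comm] using hβt.bdd_mul_of_le ht.1 hzm fun x hx ↦ hCz x (hsub hx)
  have haβ : IntervalIntegrable (fun s ↦ a s * β s) MeasureTheory.volume 0 t :=
    hβt.bdd_mul_of_le ht.1 ham fun x hx ↦ hCa x (hsub hx)
  set B : ℝ → ℝ := fun x ↦ ∫ s in (0:ℝ)..x, β s with hB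
  set Z : ℝ → ℝ := fun x ↦ ∫ s in (0:ℝ)..x, β s * z s with hZ
  have hBac : AbsolutelyContinuousOnInterval B 0 t :=
    hβt.absolutelyContinuousOnInterval_intervalIntegral (by simp)
  have hZac : AbsolutelyContinuousOnInterval Z 0 t :=
    hβz.absolutelyContinuousOnInterval_intervalIntegral (by simp)
  have hEac : AbsolutelyContinuousOnInterval (fun x ↦ Real.exp (-B x)) 0 t :=
    (Real.contDiff_exp.comp contDiff_neg).comp_absolutelyContinuousOnInterval hBac
  have hcac : AbsolutelyContinuousOnInterval (fun _ ↦ c t) 0 t :=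
    (LipschitzWith.const (c t)).lipschitzOnWith.absolutelyContinuousOnInterval
  have hFac : AbsolutelyContinuousOnInterval (fun x ↦ Real.exp (-B x) * (Z x + c t)) 0 t :=
    hEac.fun_mul (hZac.add hcac)
  have hG : IntervalIntegrable (fun s ↦ a s * β s * Real.exp (-B s)) MeasureTheory.volume 0 t :=
    haβ.mul_continuousOn hEac.continuousOn
  have hle : (∫ s in (0:ℝ)..t, deriv (fun x ↦ Real.exp (-B x) * (Z x + c t)) s) ≤
      ∫ s in (0:ℝ)..t, -(a s * β s * Real.exp (-B s)) := by
    refine intervalIntegral.integral_mono_ae_restrict ht.1 hFac.intervalIntegrable_deriv hG.neg ?_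
    refine (MeasureTheory.ae_restrict_iff' measurableSet_Icc).2 ?_
    filter_upwards [hβt.ae_hasDerivAt_integral, hβz.ae_hasDerivAt_integral] with s h₁ h₂ hs
    have hs' : s ∈ Set.uIcc 0 t := hu ▸ hs
    have hB' : HasDerivAt B (β s) s := h₁ hs' 0 (by simp)
    have hZ' : HasDerivAt Z (β s * z s) s := h₂ hs' 0 (by simp)
    have hF' := hB'.neg.exp.mul (hZ'.add_const (c t))
    have hbound : z s ≤ c t - a s + Z s := by
      have := hcmono (hsub hs) ht hs.2
      have := hineq s (hsub hs)
      linarith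
    have hnonneg : 0 ≤ Real.exp (-B s) * β s :=
      mul_nonneg (Real.exp_nonneg _) (hβnonneg s (hsub hs))
    refine hF'.deriv.trans_le ?_
    have := mul_le_mul_of_nonneg_left hbound hnonneg
    simp only [Pi.neg_apply]
    linarith
  have hB0 : B 0 = 0 := intervalIntegral.integral_same
  have hZ0 : Z 0 = 0 := intervalIntegral.integral_same
  rw [hFac.integral_deriv_eq_sub, intervalIntegral.integral_neg] at hle
  simp only [hB0, hZ0, neg_zero, Real.exp_zero, one_mul, zero_add] at hle
  have hexp : (∫ s in (0:ℝ)..t, a s * β s * Real.exp (∫ w in s..t, β w)) =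
      Real.exp (B t) * ∫ s in (0:ℝ)..t, a s * β s * Real.exp (-B s) := by
    rw [← intervalIntegral.integral_const_mul]
    refine intervalIntegral.integral_congr fun s hs ↦ ?_
    have h0s : IntervalIntegrable β MeasureTheory.volume 0 s :=
      hβt.mono_set (Set.uIcc_subset_uIcc_left hs)
    have : (∫ w in s..t, β w) = B t + -B s :=
      (intervalIntegral.integral_interval_sub_left hβt h0s).symm.trans (sub_eq_add_neg _ _)
    simp only [this, Real.exp_add]
    ring
  have hmul := mul_le_mul_of_nonneg_left hle (Real.exp_nonneg (B t))
  have hinv : Real.exp (B t) * Real.exp (-B t) = 1 := by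
    rw [← Real.exp_add, add_neg_cancel, Real.exp_zero]
  have ha : z t ≤ c t - a t + Z t := hineq t ht
  have hz := hznonneg t ht
  rw [hexp]
  rw [mul_sub, ← mul_assoc, hinv, one_mul] at hmul
  linarith
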